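/- arXiv:2211.07017 — 4 statements merged into one kernel-verified Lean document; each statement's English description precedes it below -/
import Mathlib

section
/- Let V be a finite-dimensional real inner product space and let v ∈ V be a nonzero vector. Define the symmetric bilinear form g on V by g(x,y) = ⟨v,v⟩·⟨x,y⟩ − 2·⟨v,x⟩·⟨v,y⟩. Then g is nondegenerate: if x ∈ V satisfies g(x,y) = 0 for all y ∈ V, then x = 0. Moreover g(v,x) = 0 for every x orthogonal to v, so V decomposes g-orthogonally as the span of v (on which g is negative definite) plus the inner-product orthogonal complement of v (on which g is positive definite). -/
open scoped RealInnerProductSpace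

/-- For a nonzero vector `v` in a finite-dimensional real inner product
space, the bilinear form `g x y = ⟪v,v⟫ * ⟪x,y⟫ - 2 * ⟪v,x⟫ * ⟪v,y⟫` is nondegenerate,
`g v x = 0` whenever `x ⊥ v`, and `V` decomposes `g`-orthogonally as the span of `v`
(on which `g` is negative definite) plus the inner-product orthogonal complement of `v`
(on which `g` is positive definite). -/
theorem nondegenerate_lorentz_from_riemannian
    {V : Type*} [NormedAddCommGroup V] [InnerProductSpace ℝ V]
    [FiniteDimensional ℝ V]
    (v : V) (hv : v ≠ 0)
    (g : V → V → ℝ)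
    (hg : ∀ x y : V, g x y = ⟪v, v⟫ * ⟪x, y⟫ - 2 * ⟪v, x⟫ * ⟪v, y⟫) :
    (∀ x : V, (∀ y : V, g x y = 0) → x = 0) ∧
    (∀ x : V, ⟪v, x⟫ = 0 → g v x = 0) ∧
    (∀ x : V, ∃ (α : ℝ) (w : V), x = α • v + w ∧ ⟪v, w⟫ = 0) ∧
    (∀ α : ℝ, α ≠ 0 → g (α • v) (α • v) < 0) ∧
    (∀ x : V, ⟪v, x⟫ = 0 → x ≠ 0 → 0 < g x x) := by
  have hvv : 0 < ⟪v, v⟫ := real_inner_self_pos.mpr hv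
  refine ⟨fun x hx => ?_, fun x hx => ?_, fun x => ?_, fun α hα => ?_, fun x hx hx0 => ?_⟩
  · have hvx : ⟪v, x⟫ = 0 := by
      have h := hx v
      rw [hg, real_inner_comm v x] at h
      have h' : ⟪v, v⟫ * ⟪v, x⟫ = 0 := by linarith
      exact (mul_eq_zero.mp h').resolve_left hvv.ne'
    have h := hx x
    rw [hg, hvx] at h
    have h' : ⟪v, v⟫ * ⟪x, x⟫ = 0 := by linarith
    exact inner_self_eq_zero.mp ((mul_eq_zero.mp h').resolve_left hvv.ne')
  · rw [hg, hx]
    ring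
  · refine ⟨⟪v, x⟫ / ⟪v, v⟫, x - (⟪v, x⟫ / ⟪v, v⟫) • v, by abel, ?_⟩
    rw [inner_sub_right, real_inner_smul_right, div_mul_cancel₀ _ hvv.ne', sub_self]
  · have h : g (α • v) (α • v) = -(α * ⟪v, v⟫) ^ 2 := by
      rw [hg, real_inner_smul_right, real_inner_smul_left, real_inner_smul_right]
      ring
    rw [h, neg_lt_zero]
    have := mul_ne_zero hα hvv.ne'
    positivity
  · rw [hg, hx, mul_zero, sub_zero]
    exact mul_pos hvv (real_inner_self_pos.mpr hx0)
end

section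
/- For all real numbers a, a', b, b' with |a| ≤ 1, |a'| ≤ 1, |b| ≤ 1 and |b'| ≤ 1, one has |a·b − a·b' + a'·b + a'·b'| ≤ 2. -/
/-- pointwise algebraic core of the CHSH inequality: for real numbers
`a, a', b, b'` of absolute value at most `1`,
`|a*b - a*b' + a'*b + a'*b'| ≤ 2`. -/
theorem chsh_pointwise (a a' b b' : ℝ)
    (ha : |a| ≤ 1) (ha' : |a'| ≤ 1) (hb : |b| ≤ 1) (hb' : |b'| ≤ 1) :
    |a * b - a * b' + a' * b + a' * b'| ≤ 2 := by
  have h_sum : |a + a'| + |a' - a| ≤ 2 := by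
    rw [abs_le] at ha ha'
    rcases abs_cases (a + a') with h | h <;> rcases abs_cases (a' - a) with h' | h' <;> linarith
  calc |a * b - a * b' + a' * b + a' * b'|
      = |(a + a') * b + (a' - a) * b'| := by ring_nf
    _ ≤ |(a + a') * b| + |(a' - a) * b'| := abs_add_le _ _
    _ = |a + a'| * |b| + |a' - a| * |b'| := by rw [abs_mul, abs_mul]
    _ ≤ |a + a'| + |a' - a| :=
        add_le_add (mul_le_of_le_one_right (abs_nonneg _) hb)
          (mul_le_of_le_one_right (abs_nonneg _) hb')
    _ ≤ 2 := h_sum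
end

section
/- Let (Ω, 𝓕, μ) be a probability space and let f, f', g, g' : Ω → ℝ be measurable functions satisfying |f(ω)| ≤ 1, |f'(ω)| ≤ 1, |g(ω)| ≤ 1 and |g'(ω)| ≤ 1 for μ-almost every ω. Then the correlation coefficients E(x,y) = ∫ x·y dμ satisfy the CHSH inequality: |∫ f·g dμ − ∫ f·g' dμ + ∫ f'·g dμ + ∫ f'·g' dμ| ≤ 2. -/
open MeasureTheory

/-- The pointwise CHSH bound for real numbers in `[-1, 1]`. -/
lemma abs_chsh_le_two {a b c d : ℝ} (ha : |a| ≤ 1) (hb : |b| ≤ 1) (hc : |c| ≤ 1)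
    (hd : |d| ≤ 1) : |a * c - a * d + b * c + b * d| ≤ 2 := by
  have hsum : |c - d| + |c + d| ≤ 2 := by
    rw [abs_le] at hc hd
    rcases abs_cases (c - d) with h | h <;> rcases abs_cases (c + d) with h' | h' <;> linarith
  calc |a * c - a * d + b * c + b * d| = |a * (c - d) + b * (c + d)| := by ring_nf
    _ ≤ |a| * |c - d| + |b| * |c + d| := by
      simpa only [abs_mul] using abs_add_le (a * (c - d)) (b * (c + d))
    _ ≤ 1 * |c - d| + 1 * |c + d| := by gcongr
    _ ≤ 2 := by linarith

/-- A product of two measurable functions with values almost surely in `[-1, 1]` is integrable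
with respect to a finite measure. -/
lemma integrable_mul_of_abs_le_one {Ω : Type*} [MeasurableSpace Ω] {μ : Measure Ω}
    [IsFiniteMeasure μ] {x y : Ω → ℝ} (hx : Measurable x) (hy : Measurable y)
    (hbx : ∀ᵐ ω ∂μ, |x ω| ≤ 1) (hby : ∀ᵐ ω ∂μ, |y ω| ≤ 1) :
    Integrable (fun ω ↦ x ω * y ω) μ := by
  refine Integrable.of_bound (hx.mul hy).aestronglyMeasurable 1 ?_
  filter_upwards [hbx, hby] with ω h₁ h₂
  rw [Real.norm_eq_abs, abs_mul]
  exact mul_le_one₀ h₁ (abs_nonneg _) h₂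

/-- CHSH inequality, probabilistic form; Bell's second theorem à la
Nelson–Faris: for measurable random variables `f, f', g, g'` on a probability space
with values almost surely in `[-1, 1]`, the correlation coefficients
`E(x,y) = ∫ x·y dμ` satisfy
`|∫ f·g − ∫ f·g' + ∫ f'·g + ∫ f'·g'| ≤ 2`. -/
theorem chsh_inequality
    {Ω : Type*} [MeasurableSpace Ω] (μ : Measure Ω) [IsProbabilityMeasure μ]
    (f f' g g' : Ω → ℝ)
    (hf : Measurable f) (hf' : Measurable f')
    (hg : Measurable g) (hg' : Measurable g')
    (hbf : ∀ᵐ ω ∂μ, |f ω| ≤ 1) (hbf' : ∀ᵐ ω ∂μ, |f' ω| ≤ 1)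
    (hbg : ∀ᵐ ω ∂μ, |g ω| ≤ 1) (hbg' : ∀ᵐ ω ∂μ, |g' ω| ≤ 1) :
    |(∫ ω, f ω * g ω ∂μ) - (∫ ω, f ω * g' ω ∂μ)
      + (∫ ω, f' ω * g ω ∂μ) + (∫ ω, f' ω * g' ω ∂μ)| ≤ 2 := by
  have hfg := integrable_mul_of_abs_le_one hf hg hbf hbg
  have hfg' := integrable_mul_of_abs_le_one hf hg' hbf hbg'
  have hf'g := integrable_mul_of_abs_le_one hf' hg hbf' hbg
  have hf'g' := integrable_mul_of_abs_le_one hf' hg' hbf' hbg'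
  rw [← integral_sub hfg hfg', ← integral_add (by exact hfg.sub hfg') hf'g,
    ← integral_add (by exact (hfg.sub hfg').add hf'g) hf'g', ← Real.norm_eq_abs]
  refine (norm_integral_le_of_norm_le_const (C := 2) ?_).trans_eq (by simp)
  filter_upwards [hbf, hbf', hbg, hbg'] with ω ha hb hc hd
  exact abs_chsh_le_two ha hb hc hd
end

section
/- Let E be an invertible 4×4 real matrix, let η be the Minkowski matrix diag(−1,1,1,1), and for λ > 0 set e(λ) = λ·E (a degenerating family of tetrads with variation δe = E = d e(λ)/dλ). Define the Giddings norm density N(λ) = det(e(λ)) · Σ_{a,b,c,d,μ,ν} η^{ab} η_{cd} (e(λ)⁻¹)^μ_a (e(λ)⁻¹)^ν_b (δe)^c_μ (δe)^d_ν. Then N(λ) = 4·λ²·det(E) for all λ > 0, and hence N(λ) tends to 0 as λ → 0⁺; in particular the Giddings inner product remains finite for tetrads degenerating as e^a_μ(λ) = λ e^a_μ(1). -/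
open scoped Matrix

/-- The Minkowski matrix `diag(-1, 1, 1, 1)` (which is its own inverse, so it also
represents the components `η^{ab}`). -/
def minkowskiEta : Matrix (Fin 4) (Fin 4) ℝ :=
  Matrix.diagonal ![-1, 1, 1, 1]

/-- Contracting `E` with `F` over both coordinate indices gives two entries of `E * F`. -/
theorem sum_sum_contract_eq_mul {n : Type*} [Fintype n] (E F : Matrix n n ℝ) (r : ℝ)
    (a b c d : n) :
    ∑ μ : n, ∑ ν : n, r * F μ a * F ν b * E c μ * E d ν =
      r * ((E * F) c a * (E * F) d b) := by
  rw [Matrix.mul_apply, Matrix.mul_apply, Finset.sum_mul_sum]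
  simp only [Finset.mul_sum]
  exact Finset.sum_congr rfl fun μ _ => Finset.sum_congr rfl fun ν _ => by ring

/-- The Giddings contraction when `F` is a scalar multiple of the inverse of `E`. -/
theorem giddings_contraction_of_mul_eq_smul_one (E F : Matrix (Fin 4) (Fin 4) ℝ) (k : ℝ)
    (h : E * F = k • (1 : Matrix (Fin 4) (Fin 4) ℝ)) :
    ∑ a : Fin 4, ∑ b : Fin 4, ∑ c : Fin 4, ∑ d : Fin 4, ∑ μ : Fin 4, ∑ ν : Fin 4,
      minkowskiEta a b * minkowskiEta c d * F μ a * F ν b * E c μ * E d ν = 4 * k ^ 2 := by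
  simp only [sum_sum_contract_eq_mul, h]
  simp [Fin.sum_univ_four, minkowskiEta, Matrix.diagonal_apply, Matrix.one_apply]
  ring

/-- finiteness of the Giddings tetrad norm for degenerating tetrads:
for an invertible tetrad `E` and the degenerating family `e(λ) = λ • E` with
variation `δe = E`, the Giddings norm density
`N(λ) = det(e(λ)) · Σ η^{ab} η_{cd} (e(λ)⁻¹)^μ_a (e(λ)⁻¹)^ν_b (δe)^c_μ (δe)^d_ν`
equals `4 λ² det E` for all `λ > 0`, hence tends to `0` as `λ → 0⁺`. -/
theorem giddings_norm_degenerating_tetrad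
    (E : Matrix (Fin 4) (Fin 4) ℝ) (hE : IsUnit E.det)
    (N : ℝ → ℝ)
    (hN : ∀ l : ℝ, N l =
      (l • E).det *
        ∑ a : Fin 4, ∑ b : Fin 4, ∑ c : Fin 4, ∑ d : Fin 4, ∑ μ : Fin 4, ∑ ν : Fin 4,
          minkowskiEta a b * minkowskiEta c d *
            (l • E)⁻¹ μ a * (l • E)⁻¹ ν b * E c μ * E d ν) :
    (∀ l : ℝ, 0 < l → N l = 4 * l ^ 2 * E.det) ∧
    Filter.Tendsto N (nhdsWithin 0 (Set.Ioi 0)) (nhds 0) := by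
  have key : ∀ l : ℝ, 0 < l → N l = 4 * l ^ 2 * E.det := by
    intro l hl
    have hl0 : l ≠ 0 := hl.ne'
    have hdet : IsUnit (l • E).det := by
      rw [Matrix.det_smul]
      exact ((isUnit_iff_ne_zero.mpr hl0).pow _).mul hE
    have hmul : E * (l • E)⁻¹ = l⁻¹ • (1 : Matrix (Fin 4) (Fin 4) ℝ) := by
      rw [← Matrix.mul_nonsing_inv _ hdet, Matrix.smul_mul, inv_smul_smul₀ hl0]
    rw [hN, giddings_contraction_of_mul_eq_smul_one _ _ _ hmul, Matrix.det_smul,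
      Fintype.card_fin]
    field_simp
  refine ⟨key, ?_⟩
  have hlim : Filter.Tendsto (fun l : ℝ => 4 * l ^ 2 * E.det)
      (nhdsWithin 0 (Set.Ioi 0)) (nhds 0) := by
    have hcont : Continuous fun l : ℝ => 4 * l ^ 2 * E.det := by fun_prop
    simpa using (hcont.tendsto 0).mono_left nhdsWithin_le_nhds
  refine hlim.congr' ?_
  filter_upwards [self_mem_nhdsWithin] with l hl using (key l hl).symm
end
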